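/- Let (μ_n) be a sequence of probability measures on ℝ and μ a probability measure on ℝ. If for all z ∈ ℂ⁺ the Stieltjes transforms converge, S_{μ_n}(z) → S_μ(z), then μ_n converges weakly to μ. -/

import Mathlib

open MeasureTheory Filter

open scoped Topology BoundedContinuousFunction

section Resolvent

theorem Complex.sub_ofReal_ne_zero {z : ℂ} (hz : z.im ≠ 0) (x : ℝ) : z - (x : ℂ) ≠ 0 := by
  intro h
  exact hz (by simpa using congrArg Complex.im h)

/-- The function `x ↦ (z - x)⁻¹` on the real line, for `z` off the real axis. -/
noncomputable def resolventBCF (z : ℂ) (hz : z.im ≠ 0) : ℝ →ᵇ ℂ :=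
  BoundedContinuousFunction.ofNormedAddCommGroup (fun x : ℝ => (z - (x : ℂ))⁻¹)
    (Continuous.inv₀ (by fun_prop) (Complex.sub_ofReal_ne_zero hz)) |z.im|⁻¹ (fun x => by
      rw [norm_inv]
      gcongr
      simpa using Complex.abs_im_le_norm (z - (x : ℂ)))

@[simp]
theorem resolventBCF_apply (z : ℂ) (hz : z.im ≠ 0) (x : ℝ) :
    resolventBCF z hz x = (z - (x : ℂ))⁻¹ := rfl

theorem norm_resolventBCF_le (z : ℂ) (hz : z.im ≠ 0) : ‖resolventBCF z hz‖ ≤ |z.im|⁻¹ :=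
  BoundedContinuousFunction.norm_ofNormedAddCommGroup_le _ (by positivity) _

/-- The resolvent identity. -/
theorem resolventBCF_sub (z w : ℂ) (hz : z.im ≠ 0) (hw : w.im ≠ 0) :
    resolventBCF z hz - resolventBCF w hw = (w - z) • (resolventBCF z hz * resolventBCF w hw) := by
  ext x
  have h1 := Complex.sub_ofReal_ne_zero hz x
  have h2 := Complex.sub_ofReal_ne_zero hw x
  simp only [BoundedContinuousFunction.coe_sub, Pi.sub_apply, resolventBCF_apply,
    BoundedContinuousFunction.coe_smul, BoundedContinuousFunction.coe_mul, Pi.mul_apply,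
    smul_eq_mul]
  field_simp
  ring

theorem star_resolventBCF (z : ℂ) (hz : z.im ≠ 0) :
    star (resolventBCF z hz) = resolventBCF (star z) (by simpa using hz) := by
  ext x
  simp

/-- The resolvents of all points off the real axis. -/
def resolventSetBCF : Set (ℝ →ᵇ ℂ) := {g | ∃ z, ∃ hz : z.im ≠ 0, g = resolventBCF z hz}

theorem resolventBCF_mem (z : ℂ) (hz : z.im ≠ 0) : resolventBCF z hz ∈ resolventSetBCF :=
  ⟨z, hz, rfl⟩

theorem star_resolventSetBCF : star resolventSetBCF ⊆ resolventSetBCF := by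
  rintro g ⟨z, hz, h⟩
  exact ⟨star z, by simpa using hz, by rw [← star_resolventBCF z hz, ← h, star_star]⟩

/-- The closed linear span of the constants and the resolvents. -/
noncomputable def resolventSpan : Submodule ℂ (ℝ →ᵇ ℂ) :=
  (Submodule.span ℂ (insert 1 resolventSetBCF)).topologicalClosure

theorem isClosed_resolventSpan : IsClosed (resolventSpan : Set (ℝ →ᵇ ℂ)) :=
  Submodule.isClosed_topologicalClosure _

theorem subset_resolventSpan : insert 1 resolventSetBCF ⊆ (resolventSpan : Set (ℝ →ᵇ ℂ)) :=
  Submodule.subset_span.trans (Submodule.le_topologicalClosure _)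

theorem resolventBCF_mul_mem_of_ne {z w : ℂ} (hz : z.im ≠ 0) (hw : w.im ≠ 0) (hzw : z ≠ w) :
    resolventBCF z hz * resolventBCF w hw ∈ resolventSpan := by
  have h : resolventBCF z hz * resolventBCF w hw =
      (w - z)⁻¹ • (resolventBCF z hz - resolventBCF w hw) := by
    rw [resolventBCF_sub, inv_smul_smul₀ (sub_ne_zero.mpr hzw.symm)]
  rw [h]
  exact resolventSpan.smul_mem _ (resolventSpan.sub_mem
    (subset_resolventSpan (Or.inr (resolventBCF_mem z hz)))
    (subset_resolventSpan (Or.inr (resolventBCF_mem w hw))))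

theorem tendsto_resolventBCF_add_ofReal (z : ℂ) (hz : z.im ≠ 0) :
    Tendsto (fun t : ℝ => resolventBCF (z + t) (by simpa using hz)) (𝓝 0)
      (𝓝 (resolventBCF z hz)) := by
  rw [tendsto_iff_norm_sub_tendsto_zero]
  refine squeeze_zero (g := fun t : ℝ => |t| * (|z.im|⁻¹ * |z.im|⁻¹)) (fun _ => norm_nonneg _)
    (fun t => ?_) ?_
  · rw [resolventBCF_sub, norm_smul]
    have h1 : ‖z - (z + t)‖ = |t| := by simp
    rw [h1]
    gcongr
    refine (norm_mul_le _ _).trans ?_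
    gcongr
    · simpa using norm_resolventBCF_le (z + t) (by simpa using hz)
    · exact norm_resolventBCF_le z hz
  · have : Continuous fun t : ℝ => |t| * (|z.im|⁻¹ * |z.im|⁻¹) := by fun_prop
    simpa using this.tendsto 0

theorem resolventBCF_mul_mem {z w : ℂ} (hz : z.im ≠ 0) (hw : w.im ≠ 0) :
    resolventBCF z hz * resolventBCF w hw ∈ resolventSpan := by
  by_cases hzw : z = w
  · subst hzw
    have h := ((tendsto_resolventBCF_add_ofReal z hz).const_mul (resolventBCF z hz)).mono_left
      (nhdsWithin_le_nhds (s := {0}ᶜ))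
    refine isClosed_resolventSpan.mem_of_tendsto h ?_
    filter_upwards [self_mem_nhdsWithin] with t ht
    exact resolventBCF_mul_mem_of_ne _ _ (by simpa [eq_comm] using ht)
  · exact resolventBCF_mul_mem_of_ne hz hw hzw

theorem resolventBCF_mul_mem_of_mem {z : ℂ} (hz : z.im ≠ 0) {g : ℝ →ᵇ ℂ}
    (hg : g ∈ resolventSpan) : resolventBCF z hz * g ∈ resolventSpan := by
  let L : (ℝ →ᵇ ℂ) →L[ℂ] (ℝ →ᵇ ℂ) := ContinuousLinearMap.mul ℂ (ℝ →ᵇ ℂ) (resolventBCF z hz)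
  have h : resolventSpan ≤ resolventSpan.comap (L : (ℝ →ᵇ ℂ) →ₗ[ℂ] (ℝ →ᵇ ℂ)) := by
    refine Submodule.topologicalClosure_minimal _ (Submodule.span_le.mpr ?_)
      (isClosed_resolventSpan.preimage L.continuous)
    rintro g (rfl | ⟨w, hw, rfl⟩)
    · change resolventBCF z hz * 1 ∈ resolventSpan
      rw [mul_one]
      exact subset_resolventSpan (Or.inr (resolventBCF_mem z hz))
    · exact resolventBCF_mul_mem hz hw
  exact h hg

/-- The star subalgebra generated by the resolvents. -/
noncomputable def resolventStarSubalgebra : StarSubalgebra ℂ (ℝ →ᵇ ℂ) :=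
  StarAlgebra.adjoin ℂ resolventSetBCF

theorem mem_resolventSpan_of_mem_resolventStarSubalgebra {g : ℝ →ᵇ ℂ}
    (hg : g ∈ resolventStarSubalgebra) : g ∈ resolventSpan := by
  rw [resolventStarSubalgebra, ← StarSubalgebra.mem_toSubalgebra,
    StarAlgebra.adjoin_toSubalgebra, Set.union_eq_self_of_subset_right star_resolventSetBCF,
    ← Subalgebra.mem_toSubmodule, Algebra.adjoin_eq_span] at hg
  refine Submodule.span_le.mpr (fun f hf => ?_) hg
  induction hf using Submonoid.closure_induction_left with
  | one => exact subset_resolventSpan (Or.inl rfl)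
  | mul_left x hx y _ ih =>
    obtain ⟨z, hz, rfl⟩ := hx
    exact resolventBCF_mul_mem_of_mem hz ih

theorem separatesPoints_resolventStarSubalgebra :
    (resolventStarSubalgebra.map
      (BoundedContinuousFunction.toContinuousMapStarₐ ℂ)).SeparatesPoints := by
  intro x y hxy
  have hI : Complex.I.im ≠ 0 := by simp
  refine ⟨resolventBCF Complex.I hI, ⟨_, ⟨resolventBCF Complex.I hI,
    StarAlgebra.subset_adjoin ℂ _ (resolventBCF_mem _ hI), rfl⟩, rfl⟩, ?_⟩
  simpa using hxy

end Resolvent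

section Convergence

/-- The bounded continuous functions whose integrals converge along a sequence of measures. -/
def convergenceSubmodule (μs : ℕ → Measure ℝ) (μ : Measure ℝ)
    [∀ n, IsProbabilityMeasure (μs n)] [IsProbabilityMeasure μ] : Submodule ℂ (ℝ →ᵇ ℂ) where
  carrier := {g | Tendsto (fun n => ∫ x, g x ∂(μs n)) atTop (𝓝 (∫ x, g x ∂μ))}
  zero_mem' := by simp
  add_mem' {f g} hf hg := by
    simp only [Set.mem_ofPred_eq, BoundedContinuousFunction.coe_add, Pi.add_apply] at *
    simp_rw [integral_add (f.integrable (μs _)) (g.integrable (μs _)),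
      integral_add (f.integrable μ) (g.integrable μ)]
    exact hf.add hg
  smul_mem' c f hf := by
    simp only [Set.mem_ofPred_eq, BoundedContinuousFunction.coe_smul, integral_smul] at *
    exact hf.const_smul c

theorem dist_integral_le (ν : Measure ℝ) [IsProbabilityMeasure ν] (f g : ℝ →ᵇ ℂ) :
    dist (∫ x, f x ∂ν) (∫ x, g x ∂ν) ≤ dist f g := by
  rw [dist_eq_norm, ← integral_sub (f.integrable ν) (g.integrable ν), dist_eq_norm]
  simpa using (f - g).norm_integral_le_norm (μ := ν)

theorem isClosed_convergenceSubmodule (μs : ℕ → Measure ℝ) (μ : Measure ℝ)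
    [∀ n, IsProbabilityMeasure (μs n)] [IsProbabilityMeasure μ] :
    IsClosed (convergenceSubmodule μs μ : Set (ℝ →ᵇ ℂ)) := by
  refine isClosed_of_closure_subset fun f hf => ?_
  change Tendsto _ _ _
  rw [Metric.tendsto_atTop]
  intro ε hε
  obtain ⟨g, hg, hfg⟩ := Metric.mem_closure_iff.mp hf (ε / 3) (by positivity)
  obtain ⟨N, hN⟩ := Metric.tendsto_atTop.mp hg (ε / 3) (by positivity)
  refine ⟨N, fun n hn => ?_⟩
  have h1 := dist_integral_le (μs n) f g
  have h2 := dist_integral_le μ g f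
  rw [dist_comm g f] at h2
  have h3 := hN n hn
  have h4 := dist_triangle4 (∫ x, f x ∂(μs n)) (∫ x, g x ∂(μs n)) (∫ x, g x ∂μ) (∫ x, f x ∂μ)
  linarith

theorem resolventSpan_le_convergenceSubmodule (μs : ℕ → Measure ℝ) (μ : Measure ℝ)
    [∀ n, IsProbabilityMeasure (μs n)] [IsProbabilityMeasure μ]
    (h : ∀ z : ℂ, 0 < z.im →
      Tendsto (fun n => ∫ x : ℝ, (z - (x : ℂ))⁻¹ ∂(μs n)) atTop
        (𝓝 (∫ x : ℝ, (z - (x : ℂ))⁻¹ ∂μ))) :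
    resolventSpan ≤ convergenceSubmodule μs μ := by
  refine Submodule.topologicalClosure_minimal _ (Submodule.span_le.mpr ?_)
    (isClosed_convergenceSubmodule μs μ)
  rintro g (rfl | ⟨z, hz, rfl⟩)
  · change Tendsto _ _ _
    simp
  · change Tendsto (fun n => ∫ x : ℝ, (z - (x : ℂ))⁻¹ ∂(μs n)) atTop
        (𝓝 (∫ x : ℝ, (z - (x : ℂ))⁻¹ ∂μ))
    rcases lt_or_gt_of_ne hz with hz | hz
    · have key (ν : Measure ℝ) : ∫ x : ℝ, (z - (x : ℂ))⁻¹ ∂ν =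
          star (∫ x : ℝ, (star z - (x : ℂ))⁻¹ ∂ν) := by
        change _ = (starRingEnd ℂ) _
        rw [← integral_conj]
        simp
      simp_rw [key]
      exact (h (star z) (by simpa using hz)).star
    · exact h z hz

theorem re_mul_I_resolvent {y : ℝ} (hy : 0 < y) (x : ℝ) :
    1 - ((y * Complex.I) * ((y * Complex.I) - (x : ℂ))⁻¹).re = x ^ 2 / (x ^ 2 + y ^ 2) := by
  have : x ^ 2 + y ^ 2 ≠ 0 := by positivity
  simp [Complex.inv_re, Complex.inv_im, Complex.normSq_apply]
  field_simp
  ring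

theorem integral_sq_div_eq (ν : Measure ℝ) [IsProbabilityMeasure ν] {y : ℝ} (hy : 0 < y) :
    ∫ x : ℝ, x ^ 2 / (x ^ 2 + y ^ 2) ∂ν =
      1 - ((y * Complex.I) * ∫ x : ℝ, ((y * Complex.I) - (x : ℂ))⁻¹ ∂ν).re := by
  have h_int : Integrable (fun x : ℝ => (y * Complex.I) * ((y * Complex.I) - (x : ℂ))⁻¹) ν :=
    ((resolventBCF (y * Complex.I) (by simpa using hy.ne')).integrable ν).const_mul _
  simp_rw [← re_mul_I_resolvent hy]
  refine (integral_sub (integrable_const _) h_int.re).trans ?_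
  rw [← integral_const_mul]
  congr 1
  · simp
  · exact integral_re h_int

theorem sq_div_mem_Icc (x y : ℝ) : x ^ 2 / (x ^ 2 + y ^ 2) ∈ Set.Icc (0 : ℝ) 1 :=
  ⟨by positivity, div_le_one_of_le₀ (by nlinarith [sq_nonneg y]) (by positivity)⟩

theorem tendsto_integral_sq_div (ν : Measure ℝ) [IsProbabilityMeasure ν] :
    Tendsto (fun y : ℝ => ∫ x : ℝ, x ^ 2 / (x ^ 2 + y ^ 2) ∂ν) atTop (𝓝 0) := by
  have := tendsto_integral_filter_of_dominated_convergence (μ := ν) (l := atTop)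
    (F := fun (y x : ℝ) => x ^ 2 / (x ^ 2 + y ^ 2)) (f := fun _ => 0) (fun _ => (1 : ℝ))
    (.of_forall fun y => Measurable.aestronglyMeasurable (by fun_prop))
    (.of_forall fun y => .of_forall fun x => by
      rw [Real.norm_of_nonneg (sq_div_mem_Icc x y).1]
      exact (sq_div_mem_Icc x y).2)
    (integrable_const _)
    (.of_forall fun x => Tendsto.const_div_atTop
      (tendsto_atTop_add_const_left _ _ (tendsto_pow_atTop two_ne_zero)) _)
  simpa using this

theorem measure_lt_norm_le (ν : Measure ℝ) [IsProbabilityMeasure ν] {y : ℝ} (hy : 0 < y) :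
    ν {x | y < ‖x‖} ≤ ENNReal.ofReal (2 * ∫ x : ℝ, x ^ 2 / (x ^ 2 + y ^ 2) ∂ν) := by
  have h_int : Integrable (fun x : ℝ => x ^ 2 / (x ^ 2 + y ^ 2)) ν :=
    Integrable.of_mem_Icc 0 1 (by fun_prop) (.of_forall fun x => sq_div_mem_Icc x y)
  have h := mul_meas_ge_le_integral_of_nonneg
    (.of_forall fun x => (sq_div_mem_Icc x y).1) h_int (1 / 2)
  rw [← ENNReal.ofReal_toReal (measure_ne_top ν _)]
  refine ENNReal.ofReal_le_ofReal ?_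
  have hsub : {x : ℝ | y < ‖x‖} ⊆ {x | 1 / 2 ≤ x ^ 2 / (x ^ 2 + y ^ 2)} := by
    intro x hx
    have hxy : y ^ 2 < x ^ 2 := by
      rw [← sq_abs x]
      exact pow_lt_pow_left₀ hx hy.le two_ne_zero
    rw [Set.mem_ofPred_eq, div_le_div_iff₀ two_pos (by positivity)]
    linarith
  have hle : ν.real {x : ℝ | y < ‖x‖} ≤ _ := measureReal_mono hsub
  change ν.real _ ≤ _
  linarith

theorem isTightMeasureSet_range_of_stieltjes (μs : ℕ → Measure ℝ) (μ : Measure ℝ)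
    [∀ n, IsProbabilityMeasure (μs n)] [IsProbabilityMeasure μ]
    (h : ∀ z : ℂ, 0 < z.im →
      Tendsto (fun n => ∫ x : ℝ, (z - (x : ℂ))⁻¹ ∂(μs n)) atTop
        (𝓝 (∫ x : ℝ, (z - (x : ℂ))⁻¹ ∂μ))) :
    IsTightMeasureSet (Set.range μs) := by
  refine isTightMeasureSet_range_of_tendsto_limsup_measure_norm_gt ?_
  have hlim : Tendsto (fun y : ℝ => ENNReal.ofReal (2 * ∫ x : ℝ, x ^ 2 / (x ^ 2 + y ^ 2) ∂μ))
      atTop (𝓝 0) := by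
    simpa using ENNReal.tendsto_ofReal ((tendsto_integral_sq_div μ).const_mul 2)
  refine tendsto_of_tendsto_of_tendsto_of_le_of_le' tendsto_const_nhds hlim
    (.of_forall fun _ => zero_le) ?_
  filter_upwards [eventually_gt_atTop 0] with y hy
  have hconv : Tendsto (fun n => ENNReal.ofReal (2 * ∫ x : ℝ, x ^ 2 / (x ^ 2 + y ^ 2) ∂(μs n)))
      atTop (𝓝 (ENNReal.ofReal (2 * ∫ x : ℝ, x ^ 2 / (x ^ 2 + y ^ 2) ∂μ))) := by
    refine ENNReal.tendsto_ofReal (Tendsto.const_mul 2 ?_)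
    rw [integral_sq_div_eq μ hy]
    simp_rw [fun n => integral_sq_div_eq (μs n) hy]
    exact ((Complex.continuous_re.tendsto _).comp
      ((h (y * Complex.I) (by simpa using hy)).const_mul _)).const_sub 1
  rw [← hconv.limsup_eq]
  exact limsup_le_limsup (.of_forall fun n => measure_lt_norm_le (μs n) hy)

end Convergence

/-- Pointwise convergence of Stieltjes transforms on the upper half-plane implies weak
convergence of probability measures. -/
theorem weak_convergence_of_stieltjes (μs : ℕ → Measure ℝ) (μ : Measure ℝ)
    [∀ n, IsProbabilityMeasure (μs n)] [IsProbabilityMeasure μ]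
    (h : ∀ z : ℂ, 0 < z.im →
      Tendsto (fun n => ∫ x : ℝ, (z - (x : ℂ))⁻¹ ∂(μs n)) atTop
        (nhds (∫ x : ℝ, (z - (x : ℂ))⁻¹ ∂μ))) :
    ∀ f : BoundedContinuousFunction ℝ ℝ,
      Tendsto (fun n => ∫ x, f x ∂(μs n)) atTop (nhds (∫ x, f x ∂μ)) := by
  let P : ℕ → ProbabilityMeasure ℝ := fun n => ⟨μs n, inferInstance⟩
  let P₀ : ProbabilityMeasure ℝ := ⟨μ, inferInstance⟩
  have htight : IsTightMeasureSet {(P n : Measure ℝ) | n} :=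
    isTightMeasureSet_range_of_stieltjes μs μ h
  have hconv : ∀ g ∈ resolventStarSubalgebra,
      Tendsto (fun n => ∫ x, g x ∂(P n : Measure ℝ)) atTop (𝓝 (∫ x, g x ∂(P₀ : Measure ℝ))) :=
    fun g hg => resolventSpan_le_convergenceSubmodule μs μ h
      (mem_resolventSpan_of_mem_resolventStarSubalgebra hg)
  have hP : Tendsto P atTop (𝓝 P₀) :=
    ProbabilityMeasure.tendsto_of_tight_of_separatesPoints ℂ htight
      separatesPoints_resolventStarSubalgebra hconv
  exact ProbabilityMeasure.tendsto_iff_forall_integral_tendsto.mp hP
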